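/- For every integer n ≥ 1 and every integer j ≥ 2, |dl(n,j)| ≤ 1/(2(2n−1)); moreover, for every n ≥ 2, dl(n,2) = dl(n,3) = 1/(2(2n−1)) (equivalently, el(n,2) = n/(2n−1) and el(n,3) = 1/6 + 1/(2(2n−1))). -/

import Mathlib

open scoped Classical

/-- A deal of size `n` is a fixed-point-free involution of `Fin (2*n)`. -/
def IsDeal (n : ℕ) (π : Fin (2*n) → Fin (2*n)) : Prop :=
  ∀ j, π (π j) = j ∧ π j ≠ j

/-- The finite set `D_n` of all deals of size `n`. -/
noncomputable def deals (n : ℕ) : Finset (Fin (2*n) → Fin (2*n)) :=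
  Finset.univ.filter (IsDeal n)

/-- The second occurrences of `π` (positions `j` with `π j < j`), in
increasing order: `j_1 < j_2 < ... < j_n`. -/
def blockEnds {n : ℕ} (π : Fin (2*n) → Fin (2*n)) : List (Fin (2*n)) :=
  (Finset.univ.filter (fun j => π j < j)).sort (· ≤ ·)

/-- The block lengths `b_1, ..., b_n` of a deal:
`b_1 = j_1 + 1` and `b_i = j_i - j_(i-1)` for `i ≥ 2`. -/
def blockLens {n : ℕ} (π : Fin (2*n) → Fin (2*n)) : List ℕ :=
  List.zipWith (fun x y => x - y)
    ((blockEnds π).map (fun j => (j : ℕ) + 1))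
    (0 :: (blockEnds π).map (fun j => (j : ℕ) + 1))

/-- The blocks of a deal: each block length `b_i` paired with the ending
position `j_i` of the block. -/
def blocks {n : ℕ} (π : Fin (2*n) → Fin (2*n)) : List (ℕ × Fin (2*n)) :=
  List.zip (blockLens π) (blockEnds π)

/-- The `i`-th block (ending at position `j_i`) is lucky if `π j_i = j_i - 1`. -/
def IsLuckyEnd {n : ℕ} (π : Fin (2*n) → Fin (2*n)) (j : Fin (2*n)) : Prop :=
  (π j).val = (j : ℕ) - 1

/-- `b(n,j)`: total number of blocks of length `j` over all deals in `D_n`. -/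
noncomputable def bcount (n j : ℕ) : ℕ :=
  ∑ π ∈ deals n, (blockLens π).count j

/-- `l(n,j)`: total number of lucky blocks of length `j` over all deals in `D_n`. -/
noncomputable def lcount (n j : ℕ) : ℕ :=
  ∑ π ∈ deals n, (blocks π).countP (fun p => decide (p.1 = j ∧ IsLuckyEnd π p.2))

/-- `eb(n,j)`: the expected number of blocks of length `j` in a random deal. -/
noncomputable def eb (n j : ℕ) : ℝ := (bcount n j : ℝ) / ((deals n).card : ℝ)

/-- `el(n,j)`: the expected number of lucky blocks of length `j` in a random deal. -/
noncomputable def el (n j : ℕ) : ℝ := (lcount n j : ℝ) / ((deals n).card : ℝ)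

/-- `db(n,j) = eb(n,j) - 2(2n+1)/(j(j+1)(j+2))`. -/
noncomputable def db (n j : ℕ) : ℝ :=
  eb n j - 2*(2*(n:ℝ)+1) / ((j:ℝ) * ((j:ℝ)+1) * ((j:ℝ)+2))

/-- `dl(n,j) = el(n,j) - 1/(j(j-1))`. -/
noncomputable def dl (n j : ℕ) : ℝ :=
  el n j - 1 / ((j:ℝ) * ((j:ℝ)-1))

/-- `e(π)`: the number of blocks of `π` of even length. -/
noncomputable def evenBlocks {n : ℕ} (π : Fin (2*n) → Fin (2*n)) : ℕ :=
  (blockLens π).countP (fun b => decide (Even b))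

/-- `l(π)`: the number of even-length lucky blocks of `π`. -/
noncomputable def luckyEvenBlocks {n : ℕ} (π : Fin (2*n) → Fin (2*n)) : ℕ :=
  (blocks π).countP (fun p => decide (Even p.1 ∧ IsLuckyEnd π p.2))

/-- The number `(2m-1)!!` of perfect matchings of a set with `2m` elements. -/
def matchingNumber : ℕ → ℕ
  | 0 => 1
  | m + 1 => (2 * m + 1) * matchingNumber m

lemma matchingNumber_pos (m : ℕ) : 0 < matchingNumber m := by
  induction m with
  | zero => simp [matchingNumber]
  | succ m ih => simp only [matchingNumber]; positivity

lemma card_erase_erase {α : Type*} [DecidableEq α] {S : Finset α} {a b : α} {m : ℕ}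
    (ha : a ∈ S) (hb : b ∈ S) (hab : a ≠ b)
    (hS : S.card = 2 * (m + 1)) : ((S.erase a).erase b).card = 2 * m := by
  rw [Finset.card_erase_of_mem (Finset.mem_erase.2 ⟨hab.symm, hb⟩),
    Finset.card_erase_of_mem ha]
  omega

section Matchings

variable {α : Type*} [Fintype α] [DecidableEq α]

/-- The involutions of `α` that move exactly the elements of `S`. -/
noncomputable def matchingsOn (S : Finset α) : Finset (α → α) :=
  Finset.univ.filter fun f => (∀ x, f (f x) = x) ∧ ∀ x, f x ≠ x ↔ x ∈ S

lemma mem_matchingsOn {S : Finset α} {f : α → α} :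
    f ∈ matchingsOn S ↔ (∀ x, f (f x) = x) ∧ ∀ x, f x ≠ x ↔ x ∈ S := by
  simp [matchingsOn]

/-- Deleting a matched pair `{a, b}` from a matching. -/
lemma card_matchingsOn_pair {S : Finset α} {a b : α} (ha : a ∈ S) (hb : b ∈ S) (hab : a ≠ b)
    (P Q : (α → α) → Prop) [DecidablePred P] [DecidablePred Q]
    (hPQ : ∀ f ∈ matchingsOn S, f a = b →
      ∀ g : α → α, g a = a → g b = b → (∀ x, x ≠ a → x ≠ b → g x = f x) → (P f ↔ Q g)) :
    ((matchingsOn S).filter fun f => f a = b ∧ P f).card =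
      ((matchingsOn ((S.erase a).erase b)).filter Q).card := by
  let del : (α → α) → α → α := fun f x => if x = a then a else if x = b then b else f x
  let ins : (α → α) → α → α := fun f x => if x = a then b else if x = b then a else f x
  have hdel : ∀ f x, del f x = if x = a then a else if x = b then b else f x := fun _ _ => rfl
  have hins : ∀ f x, ins f x = if x = a then b else if x = b then a else f x := fun _ _ => rfl
  have key : ∀ g ∈ matchingsOn ((S.erase a).erase b), ins g ∈ matchingsOn S := by
    intro g hg
    simp only [mem_matchingsOn, Finset.mem_erase] at hg ⊢
    obtain ⟨h1, h2⟩ := hg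
    have h3 := h2 a
    have h4 := h2 b
    refine ⟨fun x => ?_, fun x => ?_⟩
    · have := h1 x
      grind
    · have := h2 x
      grind
  refine Finset.card_bij' (fun f _ => del f) (fun g _ => ins g) ?_ ?_ ?_ ?_
  · intro f hf
    simp only [Finset.mem_filter] at hf ⊢
    obtain ⟨hf, hfa, hP⟩ := hf
    refine ⟨?_, (hPQ f hf hfa (del f) (by grind) (by grind) (by grind)).1 hP⟩
    simp only [mem_matchingsOn, Finset.mem_erase] at hf ⊢
    obtain ⟨h1, h2⟩ := hf
    have h3 := h1 a
    refine ⟨fun x => ?_, fun x => ?_⟩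
    · have := h1 x
      grind
    · have := h2 x
      grind
  · intro g hg
    simp only [Finset.mem_filter] at hg ⊢
    obtain ⟨hg, hQ⟩ := hg
    have hm := key g hg
    simp only [mem_matchingsOn, Finset.mem_erase] at hg
    have h3 := hg.2 a
    have h4 := hg.2 b
    refine ⟨hm, by grind, (hPQ _ hm (by grind) g (by grind) (by grind) ?_).2 hQ⟩
    grind
  · intro f hf
    simp only [Finset.mem_filter, mem_matchingsOn] at hf
    have h3 := hf.1.1 a
    funext x
    grind
  · intro g hg
    simp only [Finset.mem_filter, mem_matchingsOn, Finset.mem_erase] at hg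
    have h3 := hg.1.2 a
    have h4 := hg.1.2 b
    funext x
    grind

lemma card_matchingsOn (m : ℕ) (S : Finset α) (hS : S.card = 2 * m) :
    (matchingsOn S).card = matchingNumber m := by
  induction m generalizing S with
  | zero =>
    have hS : S = ∅ := Finset.card_eq_zero.1 (by omega)
    subst hS
    rw [matchingNumber, Finset.card_eq_one]
    refine ⟨id, ?_⟩
    ext f
    simp only [mem_matchingsOn, Finset.mem_singleton, Finset.notMem_empty, iff_false, not_not]
    refine ⟨fun h => funext h.2, ?_⟩
    rintro rfl
    simp
  | succ m ih =>
    obtain ⟨a, ha⟩ : S.Nonempty := Finset.card_pos.1 (by omega)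
    rw [Finset.card_eq_sum_card_fiberwise (f := fun f => f a) (t := S.erase a)]
    · rw [Finset.sum_congr rfl (g := fun _ => matchingNumber m)]
      · rw [Finset.sum_const, Finset.card_erase_of_mem ha, hS, matchingNumber, smul_eq_mul]
        congr 1
      · intro b hb
        have hb' := Finset.mem_erase.1 hb
        have := card_matchingsOn_pair ha hb'.2 hb'.1.symm (fun _ => True) (fun _ => True)
          (by simp)
        simp only [and_true, Finset.filter_true] at this
        rw [this, ih _ (card_erase_erase ha hb'.2 hb'.1.symm hS)]
    · intro f hf
      have hf := mem_matchingsOn.1 (Finset.mem_coe.1 hf)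
      have h1 := hf.2 a
      have h2 := hf.2 (f a)
      have h3 := hf.1 a
      simp only [Finset.coe_erase, Set.mem_sdiff, Finset.mem_coe, Set.mem_singleton_iff]
      grind

/-- The number of matchings of `S` that match every element of `W` into `R`. -/
lemma card_matchingsOn_mapsTo (k m : ℕ) (S W R : Finset α) (hS : S.card = 2 * m)
    (hk : W.card = k) (hW : W ⊆ S) (hR : R ⊆ S) (hWR : Disjoint W R) :
    ((matchingsOn S).filter fun f => ∀ w ∈ W, f w ∈ R).card =
      R.card.descFactorial k * matchingNumber (m - k) := by
  induction k generalizing m S W R with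
  | zero =>
    have hW : W = ∅ := Finset.card_eq_zero.1 hk
    subst hW
    simp [card_matchingsOn m S hS]
  | succ k ih =>
    obtain ⟨a, ha⟩ : W.Nonempty := Finset.card_pos.1 (by omega)
    have haS := hW ha
    have haR := Finset.disjoint_left.1 hWR ha
    obtain ⟨m, rfl⟩ : ∃ m', m = m' + 1 := by
      have := Finset.card_pos.2 ⟨a, haS⟩
      exact ⟨m - 1, by omega⟩
    rw [Finset.card_eq_sum_card_fiberwise (f := fun f => f a) (t := R)]
    · rw [Finset.sum_congr rfl
        (g := fun _ => (R.card - 1).descFactorial k * matchingNumber (m - k))]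
      · rw [Finset.sum_const, smul_eq_mul, ← mul_assoc, Nat.add_sub_add_right]
        congr 1
        cases R.card with
        | zero => simp
        | succ r => rw [Nat.succ_descFactorial_succ, Nat.add_sub_cancel]
      · intro b hb
        have hbS := hR hb
        have hab : a ≠ b := fun h => haR (h ▸ hb)
        have hbW := Finset.disjoint_right.1 hWR hb
        have := card_matchingsOn_pair haS hbS hab (fun f => ∀ w ∈ W, f w ∈ R)
          (fun f => ∀ w ∈ W.erase a, f w ∈ R.erase b) (by
            intro f hf hfa g hga hgb hg
            have h1 := (mem_matchingsOn.1 hf).1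
            constructor
            · intro h w hw
              have hw := Finset.mem_erase.1 hw
              have := h w hw.2
              have := h1 w
              have := h1 a
              rw [hg w hw.1 (by grind), Finset.mem_erase]
              grind
            · intro h w hw
              by_cases hwa : w = a
              · grind
              · have := h w (Finset.mem_erase.2 ⟨hwa, hw⟩)
                rw [hg w hwa (by grind)] at this
                exact (Finset.mem_erase.1 this).2)
        rw [Finset.filter_filter]
        simp only [and_comm] at this ⊢
        rw [this, ih m _ _ _ (card_erase_erase haS hbS hab hS), Finset.card_erase_of_mem hb]
        · rw [Finset.card_erase_of_mem ha, hk, Nat.add_sub_cancel]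
        · intro x hx
          have hx := Finset.mem_erase.1 hx
          have := hW hx.2
          grind
        · intro x hx
          have hx := Finset.mem_erase.1 hx
          have := hR hx.2
          grind
        · exact Finset.disjoint_of_subset_left (Finset.erase_subset _ _)
            (Finset.disjoint_of_subset_right (Finset.erase_subset _ _) hWR)
    · intro f hf
      exact (Finset.mem_filter.1 (Finset.mem_coe.1 hf)).2 a ha

end Matchings

lemma deals_eq_matchingsOn (n : ℕ) : deals n = matchingsOn Finset.univ := by
  ext π
  simp only [deals, IsDeal, mem_matchingsOn, Finset.mem_filter, Finset.mem_univ, true_and,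
    iff_true, forall_and]

lemma card_deals (n : ℕ) : (deals n).card = matchingNumber n := by
  rw [deals_eq_matchingsOn]
  exact card_matchingsOn n _ (by simp)

/-- Position `e` is matched to `e - 1`, and the `k + 1` positions before `e` exist and are first
occurrences. -/
def LuckyRun {n : ℕ} (π : Fin (2 * n) → Fin (2 * n)) (k : ℕ) (e : Fin (2 * n)) : Prop :=
  k + 1 ≤ e.val ∧ (π e).val + 1 = e.val ∧
    ∀ x : Fin (2 * n), x < e → e.val < x.val + k + 2 → x < π x

lemma card_deals_luckyRun (m k : ℕ) (e : Fin (2 * (m + 1))) (he : k + 1 ≤ e.val) :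
    ((deals (m + 1)).filter fun π => LuckyRun π k e).card =
      (2 * m + 1 - e.val).descFactorial k * matchingNumber (m - k) := by
  have hlt := e.2
  let b : Fin (2 * (m + 1)) := ⟨e.val - 1, by omega⟩
  have hb : b.val = e.val - 1 := rfl
  have heb : e ≠ b := fun h => by have := congrArg Fin.val h; omega
  let W : Finset (Fin (2 * (m + 1))) := Finset.Ico ⟨e.val - 1 - k, by omega⟩ b
  let R : Finset (Fin (2 * (m + 1))) := Finset.Ioi e
  have hW : ∀ x, x ∈ W ↔ e.val - 1 - k ≤ x.val ∧ x.val < e.val - 1 := by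
    intro x
    simp only [W, Finset.mem_Ico, Fin.le_def, Fin.lt_def, hb]
  have hR : ∀ x, x ∈ R ↔ e.val < x.val := by
    intro x
    simp only [R, Finset.mem_Ioi, Fin.lt_def]
  have hWc : W.card = k := by
    simp only [W, Fin.card_Ico, hb]
    omega
  have hRc : R.card = 2 * m + 1 - e.val := by
    simp only [R, Fin.card_Ioi]
    omega
  rw [← hRc, ← card_matchingsOn_mapsTo k m ((Finset.univ.erase e).erase b) W R
    (card_erase_erase (Finset.mem_univ _) (Finset.mem_univ _) heb (by simp)) hWc]
  · rw [← card_matchingsOn_pair (Finset.mem_univ _) (Finset.mem_univ _) heb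
      (fun f => ∀ w ∈ W, f w ∈ R), deals_eq_matchingsOn]
    · congr 1
      refine Finset.filter_congr fun π hπ => ?_
      have hinv := (mem_matchingsOn.1 hπ).1
      constructor
      · rintro ⟨-, h2, h3⟩
        have hπe : π e = b := Fin.ext (by omega)
        refine ⟨hπe, fun w hw => ?_⟩
        have hw := (hW w).1 hw
        rw [hR]
        by_contra hcon
        have h4 := h3 w (Fin.lt_def.2 (by omega)) (by omega)
        rw [Fin.lt_def] at h4
        have h5 : π w ≠ e := by
          intro h
          have := hinv w
          rw [h, hπe] at this
          have := congrArg Fin.val this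
          omega
        have h5' : (π w).val ≠ e.val := fun h => h5 (Fin.ext h)
        have h6 := h3 (π w) (Fin.lt_def.2 (by omega)) (by omega)
        rw [hinv, Fin.lt_def] at h6
        omega
      · rintro ⟨hπe, h⟩
        refine ⟨he, by rw [hπe, hb]; omega, fun x hx hx' => ?_⟩
        rw [Fin.lt_def] at hx ⊢
        by_cases hxb : x.val = e.val - 1
        · have hxb : x = b := Fin.ext hxb
          have := hinv e
          rw [hπe] at this
          rw [hxb, this]
          omega
        · have := (hR _).1 (h x ((hW x).2 (by omega)))
          omega
    · intro f _ _ g _ _ hg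
      refine forall₂_congr fun w hw => ?_
      have hw := (hW w).1 hw
      rw [hg w]
      · rintro rfl
        omega
      · intro h
        have := congrArg Fin.val h
        omega
  · intro x hx
    have hx := (hW x).1 hx
    simp only [Finset.mem_erase, Finset.mem_univ, and_true, ne_eq, Fin.ext_iff]
    omega
  · intro x hx
    have hx := (hR x).1 hx
    simp only [Finset.mem_erase, Finset.mem_univ, and_true, ne_eq, Fin.ext_iff]
    omega
  · rw [Finset.disjoint_left]
    intro x hx hx'
    have hx := (hW x).1 hx
    have hx' := (hR x).1 hx'
    omega

/-- The number of pairs of a deal of size `m + 1` and a position satisfying `LuckyRun`. -/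
noncomputable def runCount (m k : ℕ) : ℕ :=
  ∑ π ∈ deals (m + 1), (Finset.univ.filter fun e => LuckyRun π k e).card

lemma mul_sum_range_descFactorial (k N : ℕ) :
    (k + 1) * ∑ t ∈ Finset.range N, t.descFactorial k = N.descFactorial (k + 1) := by
  induction N with
  | zero => simp
  | succ N ih =>
    rw [Finset.sum_range_succ, mul_add, ih, Nat.succ_descFactorial_succ, Nat.descFactorial_succ,
      ← add_mul]
    rcases le_or_gt k N with h | h
    · congr 1
      omega
    · simp [Nat.descFactorial_of_lt h]

lemma succ_mul_runCount (m k : ℕ) :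
    (k + 1) * runCount m k =
      (2 * m + 1 - k).descFactorial (k + 1) * matchingNumber (m - k) := by
  have h : runCount m k =
      (∑ t ∈ Finset.range (2 * m + 1 - k), t.descFactorial k) * matchingNumber (m - k) := by
    simp only [runCount, Finset.card_filter]
    rw [Finset.sum_comm]
    simp only [← Finset.card_filter]
    have : ∀ e : Fin (2 * (m + 1)), ((deals (m + 1)).filter fun π => LuckyRun π k e).card =
        (fun i : ℕ => if k + 1 ≤ i then
          (2 * m + 1 - i).descFactorial k * matchingNumber (m - k) else 0) e.val := by
      intro e
      by_cases he : k + 1 ≤ e.val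
      · simp only [he, if_true]
        exact card_deals_luckyRun m k e he
      · simp only [he, if_false, Finset.card_eq_zero]
        exact Finset.filter_eq_empty_iff.2 fun π _ h => he h.1
    rw [Finset.sum_congr rfl fun e _ => this e, Fin.sum_univ_eq_sum_range
      (fun i : ℕ => if k + 1 ≤ i then
          (2 * m + 1 - i).descFactorial k * matchingNumber (m - k) else 0) (2 * (m + 1)),
      ← Finset.sum_filter, Finset.sum_mul]
    refine Finset.sum_bij' (fun i _ => 2 * m + 1 - i) (fun i _ => 2 * m + 1 - i) ?_ ?_ ?_ ?_ ?_
    · intro i hi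
      simp only [Finset.mem_filter, Finset.mem_range] at hi ⊢
      omega
    · intro i hi
      simp only [Finset.mem_filter, Finset.mem_range] at hi ⊢
      omega
    · intro i hi
      simp only [Finset.mem_filter, Finset.mem_range] at hi
      omega
    · intro i hi
      simp only [Finset.mem_range] at hi
      omega
    · intro i _
      rfl
  rw [h, ← mul_assoc, mul_sum_range_descFactorial]

lemma runCount_eq_zero {m k : ℕ} (h : m < k) : runCount m k = 0 := by
  have := succ_mul_runCount m k
  rw [Nat.descFactorial_of_lt (by omega), zero_mul] at this
  simpa using this

lemma runCount_zero (m : ℕ) : runCount m 0 = (2 * m + 1) * matchingNumber m := by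
  simpa using succ_mul_runCount m 0

lemma runCount_succ {m k : ℕ} (h : k ≤ m) :
    ((k + 2) * runCount m (k + 1)) * (2 * m + 1 - k) =
      ((k + 1) * runCount m k) * (2 * (m - k)) := by
  rw [succ_mul_runCount m k, succ_mul_runCount m (k + 1)]
  obtain ⟨d, rfl⟩ := Nat.exists_eq_add_of_le h
  cases d with
  | zero =>
    rw [Nat.descFactorial_of_lt (by omega)]
    simp
  | succ d =>
    have e1 : 2 * (k + (d + 1)) + 1 - k = (k + 2 * d + 2) + 1 := by omega
    have e2 : 2 * (k + (d + 1)) + 1 - (k + 1) = k + 2 * d + 2 := by omega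
    have e3 : k + (d + 1) - k = d + 1 := by omega
    have e4 : k + (d + 1) - (k + 1) = d := by omega
    have e5 : k + 2 * d + 2 - (k + 1) = 2 * d + 1 := by omega
    have e6 : k + 2 * d + 2 - k = 2 * d + 2 := by omega
    rw [e1, e2, e3, e4, Nat.succ_descFactorial_succ _ k, Nat.descFactorial_succ _ (k + 1),
      Nat.descFactorial_succ _ k, e5, e6, matchingNumber]
    ring

/-- In a strictly increasing list, a block has length `j` iff it is preceded, `j` places before
its end, by the end of another block or by the starting point `p`. -/
lemma countP_zip_gaps {N : ℕ} (Q : Fin N → Prop) (j : ℕ) (hj : 1 ≤ j) (L : List (Fin N)) (p : ℕ)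
    (hL : L.Pairwise (· < ·)) (hp : ∀ x ∈ L, p ≤ x.val) :
    (List.zip (List.zipWith (fun x y => x - y) (L.map fun x : Fin N => (x : ℕ) + 1)
      (p :: L.map fun x : Fin N => (x : ℕ) + 1)) L).countP (fun q => decide (q.1 = j ∧ Q q.2)) =
    L.countP (fun e => decide (Q e ∧ (e.val + 1 = p + j ∨ ∃ x ∈ L, x.val + j = e.val) ∧
      ∀ x ∈ L, x < e → x.val + j ≤ e.val)) := by
  induction L generalizing p with
  | nil => simp
  | cons a L ih =>
    rw [List.pairwise_cons] at hL
    have hpa := hp a (by simp)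
    simp only [List.map_cons, List.zipWith_cons_cons, List.zip_cons_cons, List.countP_cons]
    rw [ih (a.val + 1) hL.2 (fun x hx => hL.1 x hx)]
    congr 1
    · refine List.countP_congr fun e he => ?_
      have hae := hL.1 e he
      simp only [decide_eq_true_eq, List.mem_cons, exists_eq_or_imp, forall_eq_or_imp]
      rw [Fin.lt_def] at hae
      simp only [Fin.lt_def]
      grind
    · congr 1
      simp only [decide_eq_true_eq, List.mem_cons, exists_eq_or_imp, forall_eq_or_imp,
        eq_iff_iff]
      have h1 : ¬ ∃ x ∈ L, x.val + j = a.val := by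
        rintro ⟨x, hx, h⟩
        have := hL.1 x hx
        rw [Fin.lt_def] at this
        omega
      have h2 : ∀ x ∈ L, x < a → x.val + j ≤ a.val := by
        intro x hx h
        exact absurd h (hL.1 x hx).asymm
      simp only [h1, or_false, lt_irrefl, false_imp_iff, true_and]
      constructor
      · rintro ⟨h, hq⟩
        exact ⟨hq, Or.inl (by omega), h2⟩
      · rintro ⟨hq, h | h, -⟩
        · exact ⟨by omega, hq⟩
        · omega

lemma blocks_eq_zip {n : ℕ} (π : Fin (2 * n) → Fin (2 * n)) :
    blocks π = List.zip (List.zipWith (fun x y => x - y)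
      ((blockEnds π).map fun x : Fin (2 * n) => (x : ℕ) + 1)
      (0 :: (blockEnds π).map fun x : Fin (2 * n) => (x : ℕ) + 1)) (blockEnds π) := by
  have h : (blockEnds π).flatMap (fun x : Fin (2 * n) => [(x : ℕ)]) = (blockEnds π).map Fin.val :=
    List.flatMap_pure_eq_map Fin.val _
  simp [blocks, blockLens, h, Function.comp_def]

lemma countP_blocks_add {n : ℕ} {π : Fin (2 * n) → Fin (2 * n)} (hπ : IsDeal n π) (k : ℕ) :
    (blocks π).countP (fun p => decide (p.1 = k + 2 ∧ IsLuckyEnd π p.2)) +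
        (Finset.univ.filter fun e => LuckyRun π (k + 1) e).card =
      (Finset.univ.filter fun e => LuckyRun π k e).card := by
  have hmem : ∀ x, x ∈ blockEnds π ↔ π x < x := by simp [blockEnds]
  have hnodup : (blockEnds π).Nodup := Finset.sort_nodup _ _
  have hfst : ∀ x, ¬ π x < x ↔ x < π x := fun x =>
    ⟨fun h => lt_of_le_of_ne (not_lt.1 h) (hπ x).2.symm, fun h => h.asymm⟩
  rw [blocks_eq_zip, countP_zip_gaps (IsLuckyEnd π) (k + 2) (by omega) (blockEnds π) 0
    (Finset.sortedLT_sort _).pairwise (by simp)]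
  rw [List.countP_eq_length_filter, ← List.toFinset_card_of_nodup (hnodup.filter _),
    ← Finset.card_union_of_disjoint]
  · congr 1
    ext e
    simp only [Finset.mem_union, List.mem_toFinset, List.mem_filter, hmem, decide_eq_true_eq,
      Finset.mem_filter, Finset.mem_univ, true_and, IsLuckyEnd, LuckyRun, Fin.lt_def]
    constructor
    · rintro (⟨h1, h2, h3, h4⟩ | ⟨h1, h2, h3⟩)
      · refine ⟨?_, by omega, fun x hx hx' => ?_⟩
        · rcases h3 with h3 | ⟨x, -, h3⟩ <;> omega
        · refine (hfst x).1 fun h => ?_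
          have := h4 x h hx
          omega
      · exact ⟨by omega, h2, fun x hx hx' => h3 x hx (by omega)⟩
    · rintro ⟨h1, h2, h3⟩
      have h4 : ∀ x : Fin (2 * n), (π x).val < x.val → x.val < e.val →
          x.val + (k + 2) ≤ e.val := by
        intro x hx hxe
        by_contra hcon
        have := h3 x hxe (by omega)
        omega
      by_cases he : e.val + 1 = k + 2
      · exact Or.inl ⟨by omega, by omega, Or.inl (by omega), h4⟩
      · have hlt := e.2
        let y : Fin (2 * n) := ⟨e.val - (k + 2), by omega⟩
        have hy : y.val = e.val - (k + 2) := rfl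
        by_cases hπy : π y < y
        · exact Or.inl ⟨by omega, by omega, Or.inr ⟨y, hπy, by omega⟩, h4⟩
        · refine Or.inr ⟨by omega, h2, fun x hx hx' => ?_⟩
          by_cases hxy : x.val = y.val
          · rw [Fin.ext hxy]
            exact (hfst y).1 hπy
          · exact h3 x hx (by omega)
  · rw [Finset.disjoint_left]
    intro e he he'
    rw [Finset.mem_filter] at he'
    replace he' := he'.2
    simp only [List.mem_toFinset, List.mem_filter, hmem, decide_eq_true_eq] at he
    obtain ⟨h1, h2, h3, h4⟩ := he
    obtain ⟨h5, h6, h7⟩ := he'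
    rcases h3 with h3 | ⟨x, hx, h3⟩
    · omega
    · have := h7 x (Fin.lt_def.2 (by omega)) (by omega)
      exact this.asymm hx

lemma lcount_add_runCount (m k : ℕ) :
    lcount (m + 1) (k + 2) + runCount m (k + 1) = runCount m k := by
  rw [lcount, runCount, runCount, ← Finset.sum_add_distrib]
  refine Finset.sum_congr rfl fun π hπ => ?_
  exact countP_blocks_add (Finset.mem_filter.1 hπ).2 k

/-- The normalised value `(k + 1) * runCount m k / |D_m|`. -/
noncomputable def runRatio (m k : ℕ) : ℝ :=
  ((k : ℝ) + 1) * runCount m k / matchingNumber m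

lemma runRatio_nonneg (m k : ℕ) : 0 ≤ runRatio m k := by
  unfold runRatio
  positivity

lemma runRatio_zero (m : ℕ) : runRatio m 0 = 2 * m + 1 := by
  have := (Nat.cast_pos (α := ℝ)).2 (matchingNumber_pos m)
  rw [runRatio, runCount_zero]
  push_cast
  field_simp
  ring

lemma runRatio_eq_zero {m k : ℕ} (h : m < k) : runRatio m k = 0 := by
  simp [runRatio, runCount_eq_zero h]

lemma runRatio_succ {m k : ℕ} (h : k ≤ m) :
    runRatio m (k + 1) * (2 * m + 1 - k) = runRatio m k * (2 * m - 2 * k) := by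
  have hD := (Nat.cast_pos (α := ℝ)).2 (matchingNumber_pos m)
  have := congrArg (Nat.cast (R := ℝ)) (runCount_succ h)
  rw [Nat.cast_mul, Nat.cast_mul (_ * _), Nat.cast_sub (by omega)] at this
  push_cast [Nat.cast_sub h] at this
  rw [runRatio, runRatio]
  push_cast
  field_simp
  linear_combination this

lemma el_eq (m k : ℕ) :
    el (m + 1) (k + 2) =
      (runRatio m k / (k + 1) - runRatio m (k + 1) / (k + 2)) / (2 * m + 1) := by
  have hD := (Nat.cast_pos (α := ℝ)).2 (matchingNumber_pos m)
  have := congrArg (Nat.cast (R := ℝ)) (lcount_add_runCount m k)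
  rw [Nat.cast_add] at this
  rw [el, card_deals, matchingNumber, runRatio, runRatio, eq_sub_of_add_eq this]
  push_cast
  field_simp
  ring

lemma runRatio_le {m k : ℕ} (h : k ≤ m) :
    runRatio m k * (2 * (2 * m + 2 + k * (k + 1))) ≤
      (2 * (2 * m + 1) + (k + 1) * (k + 2)) * (2 * m + 1 - k) := by
  induction k with
  | zero =>
    rw [runRatio_zero]
    push_cast
    nlinarith
  | succ k ih =>
    have hrec := runRatio_succ (m := m) (k := k) (by omega)
    have hk : (0 : ℝ) ≤ k := k.cast_nonneg
    have hkm : (k : ℝ) + 1 ≤ m := mod_cast h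
    have h1 : (0 : ℝ) < 2 * m + 1 - k := by linarith
    have h2 : (0 : ℝ) < 2 * m + 2 + k * (k + 1) := by positivity
    have h3 : (0 : ℝ) ≤ (2 * m - 2 * k) * (2 * m + 2 + (k + 1) * (k + 2)) :=
      mul_nonneg (by linarith) (by positivity)
    have h4 := mul_le_mul_of_nonneg_right (ih (by omega)) h3
    have h5 : (2 * (2 * m + 1) + ((k : ℝ) + 1) * (k + 2)) *
        ((2 * m - 2 * k) * (2 * m + 2 + (k + 1) * (k + 2))) ≤
        (2 * (2 * m + 1) + (k + 2) * (k + 3)) * (2 * m - k) * (2 * m + 2 + k * (k + 1)) := by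
      have : (0 : ℝ) ≤ 3 * (k * (k + 1) * (k + 2)) * (2 * m + 2) +
        (k + 1) ^ 2 * (k + 2) ^ 2 * k := by positivity
      linear_combination this
    push_cast
    refine le_of_mul_le_mul_right ?_ (mul_pos h1 h2)
    linear_combination h4 + (2 * m + 1 - k) * h5 +
      2 * (2 * m + 2 + (k + 1) * (k + 2)) * (2 * m + 2 + k * (k + 1)) * hrec

lemma le_runRatio {m k : ℕ} (h : k ≤ m) :
    (2 * (2 * m + 1) - (k + 1) * (k + 2)) * (2 * m + 1 - k) ≤
      runRatio m k * (2 * (2 * m + 2 + k * (k + 1))) := by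
  induction k with
  | zero =>
    rw [runRatio_zero]
    push_cast
    nlinarith
  | succ k ih =>
    have hrec := runRatio_succ (m := m) (k := k) (by omega)
    have hk : (0 : ℝ) ≤ k := k.cast_nonneg
    have hkm : (k : ℝ) + 1 ≤ m := mod_cast h
    have h0 : (0 : ℝ) ≤ 2 * m - k := by linarith
    have h1 : (0 : ℝ) < 2 * m + 1 - k := by linarith
    have h2 : (0 : ℝ) < 2 * m + 2 + k * (k + 1) := by positivity
    push_cast
    rcases le_total (2 * (2 * m + 1) : ℝ) ((k + 2) * (k + 3)) with hc | hc
    · have h6 : (0 : ℝ) ≤ runRatio m (k + 1) * (2 * (2 * m + 2 + (k + 1) * (k + 2))) :=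
        mul_nonneg (runRatio_nonneg _ _) (by positivity)
      have h7 := mul_nonneg (sub_nonneg.2 hc) h0
      linear_combination h6 + h7
    · have h3 : (0 : ℝ) ≤ (2 * m - 2 * k) * (2 * m + 2 + (k + 1) * (k + 2)) :=
        mul_nonneg (by linarith) (by positivity)
      have h4 := mul_le_mul_of_nonneg_right (ih (by omega)) h3
      have h5 : (2 * (2 * m + 1) - ((k : ℝ) + 2) * (k + 3)) * (2 * m - k) *
            (2 * m + 2 + k * (k + 1)) ≤
          (2 * (2 * m + 1) - (k + 1) * (k + 2)) *
            ((2 * m - 2 * k) * (2 * m + 2 + (k + 1) * (k + 2))) := by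
        have h8 : (0 : ℝ) ≤ (k + 2) * ((2 * m + 2) *
            (4 * (2 * m + 2) - ((k + 1) ^ 2 + 7 * (k + 1) + 4))) :=
          mul_nonneg (by positivity) (mul_nonneg (by positivity) (by nlinarith))
        have h9 : (0 : ℝ) ≤ (k + 2) * ((k + 1) * (k + 2) * (k ^ 2 + k + 4)) := by positivity
        linear_combination h8 + h9
      refine le_of_mul_le_mul_right ?_ (mul_pos h1 h2)
      linear_combination h4 + (2 * m + 1 - k) * h5 -
        2 * (2 * m + 2 + (k + 1) * (k + 2)) * (2 * m + 2 + k * (k + 1)) * hrec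

lemma dl_eq (m k : ℕ) :
    dl (m + 1) (k + 2) =
      ((k + 2) * runRatio m k - (k + 1) * runRatio m (k + 1) - (2 * m + 1)) /
        ((k + 1) * (k + 2) * (2 * m + 1)) := by
  rw [dl, el_eq]
  have h : (((k + 2 : ℕ) : ℝ) - 1) = k + 1 := by push_cast; ring
  rw [h]
  push_cast
  field_simp

lemma abs_runRatio_sub_le (m k : ℕ) :
    |(k + 2) * runRatio m k - (k + 1) * runRatio m (k + 1) - (2 * m + 1)| ≤
      ((k : ℝ) + 1) * (k + 2) / 2 := by
  rw [abs_le]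
  rcases le_or_gt k m with h | h
  · have hrec := runRatio_succ h
    have hkm : (k : ℝ) ≤ m := mod_cast h
    have h1 : (0 : ℝ) < 2 * m + 1 - k := by
      have : (0 : ℝ) ≤ m := m.cast_nonneg
      linarith
    have h2 := runRatio_le h
    have h3 := le_runRatio h
    constructor
    · refine le_of_mul_le_mul_right ?_ h1
      linear_combination h3 / 2 + (k + 1) * hrec
    · refine le_of_mul_le_mul_right ?_ h1
      linear_combination h2 / 2 - (k + 1) * hrec
  · rw [runRatio_eq_zero h, runRatio_eq_zero (by omega : m < k + 1)]
    have hm : (0 : ℝ) ≤ m := m.cast_nonneg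
    have hkm : (m : ℝ) + 1 ≤ k := mod_cast h
    constructor <;> nlinarith

lemma abs_dl_le (m k : ℕ) : |dl (m + 1) (k + 2)| ≤ 1 / (2 * (2 * m + 1)) := by
  have h : (0 : ℝ) < (k + 1) * (k + 2) * (2 * m + 1) := by positivity
  rw [dl_eq, abs_div, abs_of_pos h, div_le_iff₀ h]
  refine (abs_runRatio_sub_le m k).trans_eq ?_
  field_simp

lemma runRatio_one (m : ℕ) : runRatio m 1 = 2 * m := by
  have h := runRatio_succ (Nat.zero_le m)
  rw [runRatio_zero] at h
  refine mul_right_cancel₀ (b := (2 * m + 1 : ℝ)) (by positivity) ?_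
  push_cast at h
  linear_combination h

lemma runRatio_two {m : ℕ} (hm : 1 ≤ m) : runRatio m 2 = 2 * m - 2 := by
  have h := runRatio_succ hm
  rw [runRatio_one] at h
  have hm : (1 : ℝ) ≤ m := mod_cast hm
  refine mul_right_cancel₀ (b := (2 * m : ℝ)) (by positivity) ?_
  push_cast at h
  linear_combination h

lemma el_two (m : ℕ) : el (m + 1) 2 = (m + 1) / (2 * m + 1) := by
  have h := el_eq m 0
  rw [runRatio_zero, runRatio_one] at h
  rw [h]
  push_cast
  field_simp
  ring

lemma el_three {m : ℕ} (hm : 1 ≤ m) : el (m + 1) 3 = 1 / 6 + 1 / (2 * (2 * m + 1)) := by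
  have h := el_eq m 1
  rw [runRatio_one, runRatio_two hm] at h
  rw [h]
  push_cast
  field_simp
  ring

/-- For `n ≥ 1` and `j ≥ 2`, `|dl(n,j)| ≤ 1/(2(2n-1))`; moreover, for `n ≥ 2`,
`dl(n,2) = dl(n,3) = 1/(2(2n-1))` (equivalently, `el(n,2) = n/(2n-1)` and
`el(n,3) = 1/6 + 1/(2(2n-1))`). -/
theorem dl_bounds :
    (∀ n j : ℕ, 1 ≤ n → 2 ≤ j → |dl n j| ≤ 1/(2*(2*(n:ℝ)-1))) ∧
    (∀ n : ℕ, 2 ≤ n →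
      dl n 2 = 1/(2*(2*(n:ℝ)-1)) ∧ dl n 3 = 1/(2*(2*(n:ℝ)-1)) ∧
      el n 2 = (n:ℝ)/(2*(n:ℝ)-1) ∧ el n 3 = 1/6 + 1/(2*(2*(n:ℝ)-1))) := by
  refine ⟨fun n j hn hj => ?_, fun n hn => ?_⟩
  · obtain ⟨m, rfl⟩ := Nat.exists_eq_add_of_le' hn
    obtain ⟨k, rfl⟩ := Nat.exists_eq_add_of_le' hj
    have h : 2 * (((m + 1 : ℕ) : ℝ)) - 1 = 2 * m + 1 := by push_cast; ring
    rw [h]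
    exact abs_dl_le m k
  · obtain ⟨m, rfl⟩ := Nat.exists_eq_add_of_le' (one_le_two.trans hn)
    have h : 2 * (((m + 1 : ℕ) : ℝ)) - 1 = 2 * m + 1 := by push_cast; ring
    rw [h, dl, dl, el_two, el_three (by omega)]
    push_cast
    refine ⟨?_, ?_, rfl, rfl⟩
    · field_simp
      ring
    · field_simp
      ring
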